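/- arXiv:1803.07853 — 3 statements merged into one kernel-verified Lean document; each statement's English description precedes it below -/
import Mathlib

section
/- Let G be a finite p-group such that (G, Z(G)) is a Camina pair. Then |G| divides |Aut(G)|. -/
/-- `(G, Z(G))` is a Camina pair: `Z(G)` is a nontrivial proper (normal) subgroup and
`x * Z(G) ⊆ xᴳ` for every `x ∈ G \ Z(G)`. -/
def IsCaminaPairCenter (G : Type*) [Group G] : Prop :=
  Subgroup.center G ≠ ⊥ ∧ Subgroup.center G ≠ ⊤ ∧
    ∀ x : G, x ∉ Subgroup.center G → ∀ z ∈ Subgroup.center G, IsConj x (x * z)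

set_option linter.unusedSectionVars false

namespace CaminaAux

theorem zmod_two (t : ZMod 2) : t = 0 ∨ t = 1 := by
  revert t; decide

variable {p : ℕ} [Fact p.Prime] {G : Type*} [Group G]

/-- `pw u a` is the power of `u` by a residue class (meaningful when `u ^ p = 1`). -/
def pw (u : G) (a : ZMod p) : G := u ^ a.val

theorem pw_zero (u : G) : pw u (0 : ZMod p) = 1 := by simp [pw]

theorem pw_one (u : G) : pw u (1 : ZMod p) = u := by
  have : Fact (1 < p) := ⟨(Fact.out : p.Prime).one_lt⟩
  simp [pw, ZMod.val_one]

theorem pw_add {u : G} (hu : u ^ p = 1) (a b : ZMod p) : pw u (a + b) = pw u a * pw u b := by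
  unfold pw
  rw [ZMod.val_add, ← pow_eq_pow_mod _ hu, pow_add]

theorem pw_natCast {u : G} (hu : u ^ p = 1) (n : ℕ) : pw u (n : ZMod p) = u ^ n := by
  unfold pw
  rw [ZMod.val_natCast, ← pow_eq_pow_mod _ hu]

theorem pw_pow {u : G} (hu : u ^ p = 1) (a : ZMod p) (n : ℕ) :
    (pw u a) ^ n = pw u ((n : ZMod p) * a) := by
  induction n with
  | zero => simp [pw_zero]
  | succ n ih => rw [pow_succ, ih, ← pw_add hu]; congr 1; push_cast; ring

theorem pw_pow_p {u : G} (hu : u ^ p = 1) (a : ZMod p) : (pw u a) ^ p = 1 := by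
  rw [pw_pow hu]; simp [pw_zero]

theorem pw_eq_one {u : G} (hu : u ^ p = 1) (h1 : u ≠ 1) {a : ZMod p} (h : pw u a = 1) : a = 0 := by
  have ho : orderOf u = p := orderOf_eq_prime hu h1
  have : orderOf u ∣ a.val := orderOf_dvd_of_pow_eq_one h
  rw [ho] at this
  rw [← ZMod.natCast_zmod_val a]
  exact (ZMod.natCast_eq_zero_iff _ _).2 this

theorem pw_mem {u : G} {H : Subgroup G} (hu : u ∈ H) (a : ZMod p) : pw u a ∈ H := H.pow_mem hu _

theorem pw_comm {u v : G} (h : Commute u v) (a b : ZMod p) : Commute (pw u a) (pw v b) :=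
  (h.pow_left _).pow_right _

/-- additive functions -/
def IsAdd (f : G → ZMod p) : Prop := ∀ a b, f (a * b) = f a + f b

theorem IsAdd.one {f : G → ZMod p} (h : IsAdd f) : f 1 = 0 := by
  have := h 1 1; simpa using this

theorem IsAdd.inv {f : G → ZMod p} (h : IsAdd f) (a : G) : f a⁻¹ = - f a := by
  have := h a a⁻¹
  rw [mul_inv_cancel, h.one] at this
  linear_combination -this

theorem IsAdd.pow {f : G → ZMod p} (h : IsAdd f) (a : G) (n : ℕ) : f (a ^ n) = n * f a := by
  induction n with
  | zero => simp [h.one]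
  | succ n ih => rw [pow_succ, h, ih]; push_cast; ring

theorem IsAdd.pw {f : G → ZMod p} (h : IsAdd f) {a : G} (ha : f a = 0) (b : ZMod p) :
    f (pw a b) = 0 := by
  unfold CaminaAux.pw; rw [h.pow, ha, mul_zero]

/-- A proper subgroup of a finite `p`-group is killed by some nonzero additive function. -/
theorem exists_add [Finite G] (hp : IsPGroup p G) (K : Subgroup G) (hK : K ≠ ⊤) :
    ∃ f : G → ZMod p, IsAdd f ∧ (∀ k ∈ K, f k = 0) ∧ ∃ g, f g ≠ 0 := by
  have hpp : p.Prime := Fact.out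
  obtain ⟨n, hn⟩ := IsPGroup.iff_card.1 hp
  obtain ⟨m, hm⟩ := IsPGroup.iff_card.1 (hp.to_subgroup K)
  have hlt : m < n := by
    have h1 : Nat.card K ∣ Nat.card G := Subgroup.card_subgroup_dvd_card K
    have h2 : Nat.card K ≠ Nat.card G := fun h => hK (Subgroup.eq_top_of_card_eq K h)
    rw [hm, hn] at h1 h2
    have := (Nat.pow_dvd_pow_iff_le_right hpp.one_lt).1 h1
    exact lt_of_le_of_ne this (fun h => h2 (by rw [h]))
  obtain ⟨n, rfl⟩ : ∃ k, n = k + 1 := ⟨n - 1, by omega⟩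
  obtain ⟨M, hM, hKM⟩ := Sylow.exists_subgroup_card_pow_prime_le p (n := m) (m := n) 
    (by rw [hn]; exact pow_dvd_pow _ (by omega)) K hm (by omega)
  have hidx : M.index = p := by
    have := M.card_mul_index
    rw [hM, hn, pow_succ] at this
    exact Nat.eq_of_mul_eq_mul_left (pow_pos hpp.pos n) this
  have : M.Normal := Subgroup.normal_of_index_eq_minFac_card (by
    rw [hidx, hn, Nat.Prime.pow_minFac hpp (by omega)])
  have hc : Nat.card (G ⧸ M) = p := by rw [← M.index_eq_card, hidx]
  have : IsCyclic (G ⧸ M) := isCyclic_of_prime_card hc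
  have e : Multiplicative (ZMod p) ≃* (G ⧸ M) := by
    have e := zmodCyclicMulEquiv (G := G ⧸ M) inferInstance
    rwa [hc] at e
  refine ⟨fun g => (e.symm (QuotientGroup.mk g)).toAdd, fun a b => by simp, fun k hk => ?_, ?_⟩
  · have : (QuotientGroup.mk k : G ⧸ M) = 1 := (QuotientGroup.eq_one_iff k).2 (hKM hk)
    simp [this]
  · by_contra! h
    have : M = ⊤ := by
      rw [eq_top_iff]; intro g _
      have := h g
      rw [toAdd_eq_zero, EmbeddingLike.map_eq_one_iff] at this
      exact (QuotientGroup.eq_one_iff g).1 this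
    rw [this, Subgroup.index_top] at hidx
    exact hpp.ne_one hidx.symm

/-- The automorphism attached to a derivation killing its own values. -/
theorem der_aut [Finite G] (d : G → G) (h1 : ∀ g h, d (g * h) = h⁻¹ * d g * h * d h)
    (h2 : ∀ g, d (d g) = 1) : ∃ φ : MulAut G, (∀ g, φ g = g * d g) ∧
      ∀ (n : ℕ) g, (φ ^ n) g = g * d g ^ n := by
  let φ : G →* G := MonoidHom.mk' (fun g => g * d g) (fun a b => by rw [h1]; group)
  have hφ : ∀ g, φ g = g * d g := fun g => rfl
  have hfix : ∀ g, φ (d g) = d g := fun g => by rw [hφ, h2, mul_one]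
  have hinj : Function.Injective φ := by
    rw [injective_iff_map_eq_one]
    intro g hg
    have e1 : g = (d g)⁻¹ := eq_inv_of_mul_eq_one_left hg
    have e2 : φ g = g := by
      conv_lhs => rw [e1]
      rw [map_inv, hfix, ← e1]
    rw [← e2, hg]
  let ψ : MulAut G := MulEquiv.ofBijective φ (Finite.injective_iff_bijective.1 hinj)
  have hψ : ∀ g, ψ g = g * d g := fun g => rfl
  refine ⟨ψ, hψ, fun n g => ?_⟩
  induction n with
  | zero => simp
  | succ n ih =>
    have : ψ (d g) = d g := hfix g
    rw [pow_succ', MulAut.mul_apply, ih, map_mul, map_pow, this, hψ, pow_succ', mul_assoc]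

instance inn_normal : (MulAut.conj : G →* MulAut G).range.Normal := by
  constructor
  rintro _ ⟨w, rfl⟩ φ
  refine ⟨φ w, ?_⟩
  ext g
  simp [MulAut.mul_apply, MulAut.conj_apply]

theorem card_eq [Finite G] : Nat.card G =
    Nat.card (Subgroup.center G) * Nat.card (MulAut.conj : G →* MulAut G).range := by
  have hk : (MulAut.conj : G →* MulAut G).ker = Subgroup.center G := by
    ext g
    rw [MonoidHom.mem_ker, Subgroup.mem_center_iff]
    constructor
    · intro h x
      have := DFunLike.congr_fun h x
      rw [MulAut.conj_apply, MulAut.one_apply, mul_inv_eq_iff_eq_mul] at this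
      exact this.symm
    · intro h
      ext x
      rw [MulAut.conj_apply, MulAut.one_apply, mul_inv_eq_iff_eq_mul, h]
  rw [← hk, ← Subgroup.index_ker, Subgroup.card_mul_index]

/-- It suffices that `|Z|` divides `|Out|`. -/
theorem dvd_of_out [Finite G] (h : Nat.card (Subgroup.center G) ∣
    Nat.card (MulAut G ⧸ (MulAut.conj : G →* MulAut G).range)) :
    Nat.card G ∣ Nat.card (MulAut G) := by
  rw [card_eq, Subgroup.card_eq_card_quotient_mul_card_subgroup (MulAut.conj : G →* MulAut G).range]
  exact Nat.mul_dvd_mul_right h _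

theorem inner_of_not_dvd [Finite G] (hp : IsPGroup p G)
    (h : ¬ p ∣ Nat.card (MulAut G ⧸ (MulAut.conj : G →* MulAut G).range))
    (d : G → G) (h1 : ∀ g h, d (g * h) = h⁻¹ * d g * h * d h) (h2 : ∀ g, d (d g) = 1) :
    ∃ w : G, ∀ g, w * g * w⁻¹ = g * d g := by
  obtain ⟨φ, hφ, hpow⟩ := der_aut d h1 h2
  obtain ⟨n, hn⟩ := IsPGroup.iff_card.1 hp
  have e : φ ^ (p ^ n) = 1 := by
    ext g
    rw [hpow, ← hn, pow_card_eq_one', mul_one, MulAut.one_apply]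
  have hq : (QuotientGroup.mk φ : MulAut G ⧸ (MulAut.conj : G →* MulAut G).range) = 1 := by
    have a1 : orderOf (QuotientGroup.mk φ : MulAut G ⧸ (MulAut.conj : G →* MulAut G).range)
        ∣ p ^ n := by
      apply orderOf_dvd_of_pow_eq_one
      rw [← QuotientGroup.mk_pow, e, QuotientGroup.mk_one]
    have a2 := orderOf_dvd_natCard
      (QuotientGroup.mk φ : MulAut G ⧸ (MulAut.conj : G →* MulAut G).range)
    have hcop : Nat.Coprime (p ^ n)
        (Nat.card (MulAut G ⧸ (MulAut.conj : G →* MulAut G).range)) :=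
      Nat.Coprime.pow_left _ (((Fact.out : p.Prime).coprime_iff_not_dvd).2 h)
    exact orderOf_eq_one_iff.1 (Nat.eq_one_of_dvd_coprimes hcop a1 a2)
  obtain ⟨w, hw⟩ := (QuotientGroup.eq_one_iff φ).1 hq
  exact ⟨w, fun g => by rw [← hφ, ← hw, MulAut.conj_apply]⟩

theorem camina [Finite G] (hC : IsCaminaPairCenter G) {w : G} (hw : w ∉ Subgroup.center G)
    {c : G} (hc : c ∈ Subgroup.center G) : ∃ h, w * h * w⁻¹ = h * c := by
  obtain ⟨h, hh⟩ := isConj_iff.1 (hC.2.2 w hw c hc)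
  refine ⟨h⁻¹, ?_⟩
  have e2 : w * c = c * w := Subgroup.mem_center_iff.1 hc w
  calc w * h⁻¹ * w⁻¹ = h⁻¹ * (h * w * h⁻¹) * w⁻¹ := by group
    _ = h⁻¹ * c := by rw [hh, e2]; group

theorem key [Finite G] (hC : IsCaminaPairCenter G) {w : G} {d : G → G}
    (hw : ∀ g, w * g * w⁻¹ = g * d g) {g₀ : G} (hg : d g₀ ≠ 1)
    {c : G} (hc : c ∈ Subgroup.center G) : ∃ h, d h = c := by
  have hwc : w ∉ Subgroup.center G := by
    intro h
    have h1 := Subgroup.mem_center_iff.1 h g₀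
    have h2 := hw g₀
    rw [← h1, mul_inv_cancel_right] at h2
    exact hg (left_eq_mul.1 h2)
  obtain ⟨h, hh⟩ := camina hC hwc hc
  exact ⟨h, mul_left_cancel ((hw h).symm.trans hh)⟩

theorem add_center [Finite G] (hC : IsCaminaPairCenter G) {f : G → ZMod p} (hf : IsAdd f)
    {c : G} (hc : c ∈ Subgroup.center G) : f c = 0 := by
  obtain ⟨w, hw⟩ : ∃ w, w ∉ Subgroup.center G := by
    by_contra! h
    exact hC.2.1 (eq_top_iff.2 fun g _ => h g)
  obtain ⟨h, hh⟩ := camina hC hw hc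
  have := congrArg f hh
  simp only [hf _ _, hf.inv] at this
  linear_combination -this

/-- `x` is conjugated by `g` to `x * z ^ f g`. -/
def P (z x : G) (f : G → ZMod p) : Prop := ∀ g, g⁻¹ * x * g = x * pw z (f g)

theorem P.pow {z x : G} {f : G → ZMod p} (hz : z ∈ Subgroup.center G) (hzp : z ^ p = 1)
    (h : P z x f) (n : ℕ) : P z (x ^ n) (fun g => (n : ZMod p) * f g) := by
  intro g
  have h1 : g⁻¹ * x ^ n * g = (g⁻¹ * x * g) ^ n := by
    have := conj_pow (i := n) (a := g⁻¹) (b := x)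
    rw [inv_inv] at this
    exact this.symm
  have h2 : Commute x (pw z (f g)) := Subgroup.mem_center_iff.1 (pw_mem hz _) x
  rw [h1, h g, h2.mul_pow, pw_pow hzp]

theorem P.pw {z x : G} {f : G → ZMod p} (hz : z ∈ Subgroup.center G) (hzp : z ^ p = 1)
    (h : P z x f) (a : ZMod p) : P z (pw x a) (fun g => a * f g) := by
  have := P.pow hz hzp h a.val
  rwa [ZMod.natCast_zmod_val] at this

theorem P.mul {z x y : G} {f f' : G → ZMod p} (hz : z ∈ Subgroup.center G) (hzp : z ^ p = 1)
    (h : P z x f) (h' : P z y f') : P z (x * y) (fun g => f g + f' g) := by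
  intro g
  have h2 : y * CaminaAux.pw z (f g) = CaminaAux.pw z (f g) * y :=
    Subgroup.mem_center_iff.1 (pw_mem hz _) y
  calc g⁻¹ * (x * y) * g = (g⁻¹ * x * g) * (g⁻¹ * y * g) := by group
    _ = x * (CaminaAux.pw z (f g) * y) * CaminaAux.pw z (f' g) := by rw [h, h']; group
    _ = _ := by rw [← h2, pw_add hzp]; group

theorem P.eq_zero {z x : G} {f : G → ZMod p} (hzp : z ^ p = 1) (hz1 : z ≠ 1)
    (h : P z x f) {g : G} (hg : g * x = x * g) : f g = 0 := by
  have := h g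
  rw [mul_assoc, ← hg, inv_mul_cancel_left, left_eq_mul] at this
  exact pw_eq_one hzp hz1 this

theorem P.mem_center {z x : G} {f : G → ZMod p} (h : P z x f) (hf : ∀ g, f g = 0) :
    x ∈ Subgroup.center G := by
  rw [Subgroup.mem_center_iff]
  intro g
  have := h g
  rw [hf, pw_zero, mul_one, mul_assoc, inv_mul_eq_iff_eq_mul] at this
  exact this.symm

/-- All good derivations are inner. -/
def AllInner (G : Type*) [Group G] : Prop :=
  ∀ d : G → G, (∀ g h, d (g * h) = h⁻¹ * d g * h * d h) → (∀ g, d (d g) = 1) →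
    ∃ w : G, ∀ g, w * g * w⁻¹ = g * d g

theorem conj_mul (h a b : G) : h⁻¹ * (a * b) * h = (h⁻¹ * a * h) * (h⁻¹ * b * h) := by group

theorem conj_central {z : G} (hz : z ∈ Subgroup.center G) (h : G) : h⁻¹ * z * h = z := by
  rw [mul_assoc, ← Subgroup.mem_center_iff.1 hz h, inv_mul_cancel_left]

theorem odd_case [Finite G] (hC : IsCaminaPairCenter G) (H : AllInner G) {z x : G}
    {f : G → ZMod p} (hz : z ∈ Subgroup.center G) (hzp : z ^ p = 1) (hz1 : z ≠ 1)
    (hf : IsAdd f) (hP : P z x f) (hx : x ^ p = 1) (h2 : (2 : ZMod p) ≠ 0)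
    {g₀ : G} (hg₀ : f g₀ ≠ 0) : False := by
  have hfz : f z = 0 := add_center hC hf hz
  have hfx : f x = 0 := hP.eq_zero hzp hz1 rfl
  set d : G → G := fun g => pw x (f g) * pw z (f g ^ 2 * 2⁻¹) with hd
  have hzc : ∀ (a : ZMod p) (g : G), g * pw z a = pw z a * g :=
    fun a => Subgroup.mem_center_iff.1 (pw_mem hz a)
  have hfd : ∀ g, f (d g) = 0 := fun g => by
    simp only [hd]; rw [hf, hf.pw hfx, hf.pw hfz, add_zero]
  have hd0 : ∀ g, f g = 0 → d g = 1 := fun g hg => by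
    simp [hd, hg, pw_zero]
  have hdP : ∀ h, d h ∈ Subgroup.center G → f h = 0 := by
    intro h hh
    have h3 : pw x (f h) ∈ Subgroup.center G := by
      have := Subgroup.mul_mem _ hh (Subgroup.inv_mem _ (pw_mem hz (f h ^ 2 * 2⁻¹)))
      simpa [hd] using this
    have h4 := (hP.pw hz hzp (f h)).eq_zero hzp hz1 (g := g₀) (Subgroup.mem_center_iff.1 h3 g₀)
    exact (mul_eq_zero.1 h4).resolve_right hg₀
  obtain ⟨w, hw⟩ := H d (fun g h => by
    simp only [hd]
    rw [conj_mul, conj_central (pw_mem hz _), hP.pw hz hzp (f g) h, hf]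
    have e : (f g + f h) ^ 2 * 2⁻¹ = f g * f h + f g ^ 2 * 2⁻¹ + f h ^ 2 * 2⁻¹ := by
      field_simp; ring
    rw [e, pw_add hx, pw_add hzp, pw_add hzp]
    simp only [mul_assoc]
    rw [← mul_assoc (pw z (f g ^ 2 * 2⁻¹)) (pw x (f h)), ← hzc _ (pw x (f h)),
      mul_assoc, ← mul_assoc (pw z (f g * f h)) (pw x (f h)), ← hzc _ (pw x (f h)), mul_assoc])
    (fun g => hd0 _ (hfd g))
  have hne : d g₀ ≠ 1 := fun h => hg₀ (hdP _ (h ▸ Subgroup.one_mem _))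
  obtain ⟨h, hh⟩ := key hC hw hne hz
  exact hz1 (hh ▸ hd0 h (hdP h (hh ▸ hz)))

theorem two_case_a [Finite G] (hC : IsCaminaPairCenter G) (H : AllInner G) {z x : G}
    {f : G → ZMod 2} (hz : z ∈ Subgroup.center G) (hzp : z ^ 2 = 1) (hz1 : z ≠ 1)
    (hf : IsAdd f) (hP : P z x f) (hx : x ^ 2 = z)
    {g₀ : G} (hg₀ : f g₀ ≠ 0) : False := by
  have hfx : f x = 0 := hP.eq_zero hzp hz1 rfl
  have hxc : x ∉ Subgroup.center G := fun h =>
    hg₀ (hP.eq_zero hzp hz1 (Subgroup.mem_center_iff.1 h g₀))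
  have aux : ∀ a b : ZMod 2, pw x (a + b) = pw x a * pw z (a * b) * pw x b := by
    have h11 : (1 : ZMod 2) + 1 = 0 := rfl
    have h01 : ∀ a : ZMod 2, a = 0 ∨ a = 1 := by decide
    intro a b
    rcases h01 a with rfl | rfl <;> rcases h01 b with rfl | rfl
    · simp [pw_zero]
    · simp [pw_zero]
    · simp [pw_zero]
    · rw [h11, mul_one, pw_zero, pw_one, pw_one, ← hx, ← pow_succ', ← pow_succ,
        show 2 + 1 + 1 = 2 * 2 from rfl, pow_mul, hx, hzp]
  set d : G → G := fun g => pw x (f g) with hd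
  obtain ⟨w, hw⟩ := H d (fun g h => by
      simp only [hd]
      rw [hP.pw hz hzp (f g) h, hf, aux])
    (fun g => by simp only [hd]; rw [hf.pw hfx, pw_zero])
  have h01 : ∀ g, f g ≠ 0 → f g = 1 := fun g => by
    generalize f g = a; revert a; decide
  have hne : d g₀ ≠ 1 := fun h => by
    simp only [hd] at h
    rw [h01 _ hg₀, pw_one] at h
    exact hxc (h ▸ Subgroup.one_mem _)
  obtain ⟨h, hh⟩ := key hC hw hne hz
  simp only [hd] at hh
  by_cases h0 : f h = 0
  · rw [h0, pw_zero] at hh; exact hz1 hh.symm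
  · rw [h01 _ h0, pw_one] at hh; exact hxc (hh ▸ hz)

theorem two_case_b [Finite G] (hC : IsCaminaPairCenter G) (H : AllInner G) {z x y : G}
    {f f' : G → ZMod p} (hz : z ∈ Subgroup.center G) (hzp : z ^ p = 1) (hz1 : z ≠ 1)
    (hf : IsAdd f) (hP : P z x f) (hx : x ^ p = 1)
    (hf' : IsAdd f') (hP' : P z y f') (hy : y ^ p = 1) (hxy : Commute x y)
    {a b : G} (ha : f a ≠ 0) (ha' : f' a = 0) (hb : f' b ≠ 0) : False := by
  have hfz : f z = 0 := add_center hC hf hz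
  have hfz' : f' z = 0 := add_center hC hf' hz
  have hfx : f x = 0 := hP.eq_zero hzp hz1 rfl
  have hfy : f y = 0 := hP.eq_zero hzp hz1 hxy.eq.symm
  have hfx' : f' x = 0 := hP'.eq_zero hzp hz1 hxy.eq
  have hfy' : f' y = 0 := hP'.eq_zero hzp hz1 rfl
  set d : G → G := fun g => pw y (f g) * pw x (f' g) * pw z (f g * f' g) with hd
  have hzc : ∀ (a : ZMod p) (g : G), g * pw z a = pw z a * g :=
    fun a => Subgroup.mem_center_iff.1 (pw_mem hz a)
  have hd0 : ∀ g, f g = 0 → f' g = 0 → d g = 1 := fun g hg hg' => by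
    simp [hd, hg, hg', pw_zero]
  have hdP : ∀ h, d h ∈ Subgroup.center G → f h = 0 ∧ f' h = 0 := by
    intro h hh
    have h3 : pw y (f h) * pw x (f' h) ∈ Subgroup.center G := by
      have := Subgroup.mul_mem _ hh (Subgroup.inv_mem _ (pw_mem hz (f h * f' h)))
      simpa [hd] using this
    have h4 : ∀ g, f h * f' g + f' h * f g = 0 := fun g =>
      (P.mul hz hzp (hP'.pw hz hzp (f h)) (hP.pw hz hzp (f' h))).eq_zero hzp hz1 (g := g)
        (Subgroup.mem_center_iff.1 h3 g)
    have h5 := h4 a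
    rw [ha', mul_zero, zero_add] at h5
    have h6 := (mul_eq_zero.1 h5).resolve_right ha
    have h7 := h4 b
    rw [h6, zero_mul, add_zero] at h7
    exact ⟨(mul_eq_zero.1 h7).resolve_right hb, h6⟩
  obtain ⟨w, hw⟩ := H d (fun g h => by
      simp only [hd]
      rw [conj_mul, conj_mul, conj_central (pw_mem hz _), hP.pw hz hzp (f' g) h,
        hP'.pw hz hzp (f g) h, hf, hf']
      have e : (f g + f h) * (f' g + f' h)
          = f g * f' h + f' g * f h + f g * f' g + f h * f' h := by ring
      rw [e, pw_add hx, pw_add hy, pw_add hzp, pw_add hzp, pw_add hzp]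
      have c1 := (pw_comm hxy (f' g) (f h)).eq
      generalize pw x (f' g) = X at *
      generalize pw x (f' h) = X' at *
      generalize pw y (f g) = Y at *
      generalize pw y (f h) = Y' at *
      have z1 := hzc (f g * f' h)
      have z2 := hzc (f' g * f h)
      have z3 := hzc (f g * f' g)
      generalize pw z (f g * f' h) = Z1 at *
      generalize pw z (f' g * f h) = Z2 at *
      generalize pw z (f g * f' g) = Z3 at *
      generalize pw z (f h * f' h) = Z4 at *
      have k1 : ∀ a b, Z1 * (a * b) = a * (Z1 * b) := fun a b => by
        rw [← mul_assoc, ← z1, mul_assoc]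
      have k2 : ∀ a b, Z2 * (a * b) = a * (Z2 * b) := fun a b => by
        rw [← mul_assoc, ← z2, mul_assoc]
      have k3 : ∀ a b, Z3 * (a * b) = a * (Z3 * b) := fun a b => by
        rw [← mul_assoc, ← z3, mul_assoc]
      have k4 : ∀ b, X * (Y' * b) = Y' * (X * b) := fun b => by
        rw [← mul_assoc, c1, mul_assoc]
      simp only [mul_assoc, k1 X, k1 X', k1 Y', k2 X', k2 Y', k3 X', k3 Y', k4])
    (fun g => hd0 _ (by simp only [hd]; rw [hf, hf, hf.pw hfx, hf.pw hfy, hf.pw hfz]; simp)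
      (by simp only [hd]; rw [hf', hf', hf'.pw hfx', hf'.pw hfy', hf'.pw hfz']; simp))
  have hne : d a ≠ 1 := fun h => ha (hdP _ (h ▸ Subgroup.one_mem _)).1
  obtain ⟨h, hh⟩ := key hC hw hne hz
  have h9 := hdP h (hh ▸ hz)
  exact hz1 (hh ▸ hd0 h h9.1 h9.2)

theorem pow_mul_aux {u y c : G} (hc : c ∈ Subgroup.center G) (h : y * u = u * y * c) (n : ℕ) :
    (u * y) ^ n = u ^ n * y ^ n * c ^ (n.choose 2) := by
  have hcc : ∀ (k : ℕ) (g : G), g * c ^ k = c ^ k * g :=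
    fun k => Subgroup.mem_center_iff.1 (Subgroup.pow_mem _ hc k)
  have h1 : ∀ n : ℕ, y ^ n * u = u * y ^ n * c ^ n := by
    intro n
    induction n with
    | zero => simp
    | succ n ih =>
      rw [pow_succ', mul_assoc, ih, ← mul_assoc, ← mul_assoc, h, pow_succ' c]
      simp only [mul_assoc]
      rw [← mul_assoc c (y ^ n), ← (Subgroup.mem_center_iff.1 hc (y ^ n))]
      simp only [mul_assoc]
  induction n with
  | zero => simp
  | succ n ih =>
    rw [pow_succ, ih, Nat.choose_succ_succ' n 1, Nat.choose_one_right, pow_add c]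
    calc u ^ n * y ^ n * c ^ n.choose 2 * (u * y)
        = u ^ n * y ^ n * (u * y) * c ^ n.choose 2 := by rw [mul_assoc, ← hcc, ← mul_assoc]
      _ = u ^ n * (y ^ n * u) * y * c ^ n.choose 2 := by simp only [mul_assoc]
      _ = u ^ (n + 1) * (y ^ n * (c ^ n * y)) * c ^ n.choose 2 := by
        rw [h1, pow_succ]; simp only [mul_assoc]
      _ = _ := by rw [← hcc, pow_succ y]; simp only [mul_assoc]

/-- The case `|Z(G)| = p`. -/
theorem card_p_case [Finite G] (hp : IsPGroup p G) (hC : IsCaminaPairCenter G)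
    (hcard : Nat.card (Subgroup.center G) = p) (H : AllInner G) : False := by
  have hpp : p.Prime := Fact.out
  obtain ⟨⟨z, hz⟩, hz1⟩ := Subgroup.ne_bot_iff_exists_ne_one.1 hC.1
  replace hz1 : z ≠ 1 := fun h => hz1 (Subtype.ext h)
  have hzp : z ^ p = 1 := by
    have := pow_card_eq_one' (x := (⟨z, hz⟩ : Subgroup.center G))
    rw [hcard] at this
    exact congrArg Subtype.val this
  have hgen : ∀ c ∈ Subgroup.center G, ∃ t : ZMod p, c = pw z t := by
    intro c hc
    have h1 : (⟨c, hc⟩ : Subgroup.center G) ∈ Subgroup.zpowers (⟨z, hz⟩ : Subgroup.center G) :=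
      mem_zpowers_of_prime_card hcard (fun h => hz1 (congrArg Subtype.val h))
    rw [← mem_powers_iff_mem_zpowers] at h1
    obtain ⟨n, hn⟩ := h1
    refine ⟨n, ?_⟩
    rw [pw_natCast hzp]
    exact (congrArg Subtype.val hn).symm
  have hcyc : ∀ a : G, Subgroup.zpowers a ≠ ⊤ := by
    intro a ha
    apply hC.2.1
    rw [eq_top_iff]
    intro g _
    rw [Subgroup.mem_center_iff]
    intro h
    have hg : g ∈ Subgroup.zpowers a := ha ▸ Subgroup.mem_top g
    have hh : h ∈ Subgroup.zpowers a := ha ▸ Subgroup.mem_top h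
    obtain ⟨i, rfl⟩ := hg
    obtain ⟨j, rfl⟩ := hh
    exact zpow_mul_comm a j i
  have hPex : ∀ f : G → ZMod p, IsAdd f → ∃ x, P z x f := by
    intro f hf
    have hfz : f z = 0 := add_center hC hf hz
    obtain ⟨w, hw⟩ := H (fun g => pw z (f g)) (fun g h => by
        rw [conj_central (pw_mem hz _), hf, pw_add hzp])
      (fun g => by rw [hf.pw hfz, pw_zero])
    refine ⟨w, fun g => ?_⟩
    have h1 : w * g = g * pw z (f g) * w := by rw [← hw g]; group
    have h2 : w * pw z (f g) = pw z (f g) * w := Subgroup.mem_center_iff.1 (pw_mem hz _) w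
    rw [mul_assoc, h1, h2]; group
  have hcp : ∀ {x : G} {f : G → ZMod p}, P z x f → x ^ p ∈ Subgroup.center G := by
    intro x f hP
    exact (P.pow hz hzp hP p).mem_center (fun g => by simp)
  obtain ⟨f, hf, -, a, ha⟩ := exists_add hp (Subgroup.zpowers (1 : G)) (hcyc 1)
  obtain ⟨f', hf', ha', b, hb⟩ := exists_add hp (Subgroup.zpowers a) (hcyc a)
  have ha' := ha' a (Subgroup.mem_zpowers a)
  obtain ⟨x, hP⟩ := hPex f hf
  obtain ⟨y, hP'⟩ := hPex f' hf'
  rcases hpp.eq_two_or_odd' with h2 | hodd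
  · subst h2
    have hA : ∀ {x : G} {f : G → ZMod 2}, IsAdd f → P z x f → ∀ g₀, f g₀ ≠ 0 → x ^ 2 = 1 := by
      intro x f hf hP g₀ hg₀
      by_contra hne
      obtain ⟨t, ht⟩ := hgen _ (hcp hP)
      have : t = 1 := by
        rcases zmod_two t with rfl | rfl
        · rw [pw_zero] at ht; exact absurd ht hne
        · rfl
      rw [this, pw_one] at ht
      exact two_case_a hC H hz hzp hz1 hf hP ht hg₀
    have hx := hA hf hP a ha
    have hy := hA hf' hP' b hb
    have hxy := hA (f := fun g => f g + f' g) (fun g h => by simp only [hf g h, hf' g h]; ring)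
      (P.mul hz hzp hP hP') a (by simpa [ha'] using ha)
    have hcomm : Commute x y := by
      have ex : x⁻¹ = x := inv_eq_of_mul_eq_one_left (by rw [← pow_two, hx])
      have ey : y⁻¹ = y := inv_eq_of_mul_eq_one_left (by rw [← pow_two, hy])
      have exy : (x * y)⁻¹ = x * y := inv_eq_of_mul_eq_one_left (by rw [← pow_two, hxy])
      rw [mul_inv_rev, ex, ey] at exy
      exact exy.symm
    exact two_case_b hC H hz hzp hz1 hf hP hx hf' hP' hy hcomm ha ha' hb
  · have h2 : (2 : ZMod p) ≠ 0 := by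
      intro h
      have : p ∣ 2 := (ZMod.natCast_eq_zero_iff 2 p).1 (by exact_mod_cast h)
      have := (Nat.prime_dvd_prime_iff_eq hpp Nat.prime_two).1 this
      subst this
      exact absurd hodd (by decide)
    have hp2 : 2 < p := by
      rcases hodd with ⟨k, hk⟩
      have := hpp.two_le
      omega
    obtain ⟨s, hs⟩ := hgen _ (hcp hP)
    obtain ⟨t, ht⟩ := hgen _ (hcp hP')
    by_cases hs0 : s = 0
    · rw [hs0, pw_zero] at hs
      exact odd_case hC H hz hzp hz1 hf hP hs h2 ha
    · set i : ZMod p := -t * s⁻¹ with hi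
      have hPi := hP.pw hz hzp i
      have hPy := P.mul hz hzp hP' hPi
      have hc : pw x i * y = y * pw x i * pw z (i * f y) := by
        have := hPi y
        rw [mul_assoc, inv_mul_eq_iff_eq_mul] at this
        rw [this, mul_assoc]
      have hpow : (y * pw x i) ^ p = 1 := by
        rw [pow_mul_aux (pw_mem hz _) hc]
        obtain ⟨k, hk⟩ := hpp.dvd_choose_self (k := 2) (by norm_num) hp2
        rw [hk, pow_mul, pw_pow_p hzp, one_pow, mul_one, ht]
        have : pw x i ^ p = pw z (i * s) := by
          unfold pw
          rw [← pow_mul, mul_comm, pow_mul, hs]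
          change pw z s ^ i.val = pw z (i * s)
          rw [pw_pow hzp, ZMod.natCast_zmod_val]
        rw [this, ← pw_add hzp, hi]
        have : t + -t * s⁻¹ * s = 0 := by field_simp; ring
        rw [this, pw_zero]
      by_cases hi0 : i = 0
      · refine odd_case hC H hz hzp hz1 (f := fun g => f' g + i * f g)
          (fun g h => by simp only [hf g h, hf' g h]; ring) hPy hpow h2 (g₀ := b) ?_
        simpa [hi0] using hb
      · refine odd_case hC H hz hzp hz1 (f := fun g => f' g + i * f g)
          (fun g h => by simp only [hf g h, hf' g h]; ring) hPy hpow h2 (g₀ := a) ?_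
        simpa [ha'] using ⟨hi0, ha⟩

/-- `Z(G)` has exponent `p`. -/
theorem center_exp [Finite G] (hp : IsPGroup p G) (hC : IsCaminaPairCenter G) {c : G}
    (hc : c ∈ Subgroup.center G) : c ^ p = 1 := by
  obtain ⟨x, hx, hxp⟩ : ∃ x, x ∉ Subgroup.center G ∧ x ^ p ∈ Subgroup.center G := by
    have hq : IsPGroup p (G ⧸ Subgroup.center G) := hp.to_quotient _
    have hd : p ∣ Nat.card (G ⧸ Subgroup.center G) := by
      refine hq.card_eq_or_dvd.resolve_left fun h => hC.2.1 ?_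
      rw [← Subgroup.index_eq_card] at h
      exact Subgroup.index_eq_one.1 h
    obtain ⟨q, hq⟩ := exists_prime_orderOf_dvd_card' p hd
    obtain ⟨x, rfl⟩ := QuotientGroup.mk_surjective q
    refine ⟨x, fun h => ?_, ?_⟩
    · rw [(QuotientGroup.eq_one_iff x).2 h, orderOf_one] at hq
      exact (Fact.out : p.Prime).ne_one hq.symm
    · rw [← QuotientGroup.eq_one_iff, QuotientGroup.mk_pow, ← hq, pow_orderOf_eq_one]
  obtain ⟨h, hh⟩ := camina hC hx hc
  have hcx := Subgroup.mem_center_iff.1 hc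
  have h1 : ∀ n : ℕ, x ^ n * h = h * c ^ n * x ^ n := by
    intro n
    induction n with
    | zero => simp
    | succ n ih =>
      have e : x * h = h * c * x := by rw [← hh]; group
      have hcn := Subgroup.mem_center_iff.1 (Subgroup.pow_mem _ hc n)
      calc x ^ (n + 1) * h = x * (x ^ n * h) := by rw [pow_succ', mul_assoc]
        _ = (x * h) * c ^ n * x ^ n := by rw [ih]; simp only [mul_assoc]
        _ = h * c * (x * c ^ n) * x ^ n := by rw [e]; simp only [mul_assoc]
        _ = h * c ^ (n + 1) * x ^ (n + 1) := by
          rw [hcn x, pow_succ' c, pow_succ' x]; simp only [mul_assoc]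
  have h2 := h1 p
  rw [← Subgroup.mem_center_iff.1 hxp h, mul_assoc, mul_right_inj, right_eq_mul] at h2
  exact h2

/-- The case `|Z(G)| ≠ p`. -/
theorem card_ne_case [Finite G] (hp : IsPGroup p G) (hC : IsCaminaPairCenter G)
    (hcard : Nat.card (Subgroup.center G) ≠ p) : Nat.card (Subgroup.center G) ∣
      Nat.card (MulAut G ⧸ (MulAut.conj : G →* MulAut G).range) := by
  have hpp : p.Prime := Fact.out
  obtain ⟨f, hf, -, g₀, hg₀⟩ := exists_add hp (Subgroup.center G) hC.2.1
  have hfc : ∀ c ∈ Subgroup.center G, f c = 0 := fun c hc => add_center hC hf hc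
  have hex : ∀ c : Subgroup.center G, ∃ φ : MulAut G, ∀ g, φ g = g * pw c.1 (f g) := by
    intro c
    obtain ⟨φ, hφ, -⟩ := der_aut (fun g => pw c.1 (f g)) (fun g h => by
        rw [conj_central (pw_mem c.2 _), hf, pw_add (center_exp hp hC c.2)])
      (fun g => by rw [hfc _ (pw_mem c.2 _), pw_zero])
    exact ⟨φ, hφ⟩
  choose φ hφ using hex
  let Φ : Subgroup.center G →* MulAut G := MonoidHom.mk' φ (fun c c' => by
    ext g
    rw [MulAut.mul_apply, hφ, hφ, hφ, hf, hfc _ (pw_mem c'.2 _), add_zero, mul_assoc]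
    congr 1
    have : Commute c.1 c'.1 := Subgroup.mem_center_iff.1 c'.2 c.1
    rw [← (pw_comm this _ _).eq]
    exact this.mul_pow _)
  have hΦ : ∀ c, Φ c = φ c := fun c => rfl
  refine Subgroup.card_dvd_of_injective
    ((QuotientGroup.mk' (MulAut.conj : G →* MulAut G).range).comp Φ) ?_
  rw [injective_iff_map_eq_one]
  intro c hc
  by_contra hc1
  have hc1' : c.1 ≠ 1 := fun h => hc1 (Subtype.ext h)
  obtain ⟨w, hw⟩ := (QuotientGroup.eq_one_iff (Φ c)).1 hc
  have hw' : ∀ g, w * g * w⁻¹ = g * pw c.1 (f g) := fun g => by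
    rw [← hφ, ← hΦ, ← hw, MulAut.conj_apply]
  have hne : pw c.1 (f g₀) ≠ 1 := fun h => hg₀ (pw_eq_one (center_exp hp hC c.2) hc1' h)
  have hsurj : Function.Surjective
      (fun a : ZMod p => (⟨pw c.1 a, pw_mem c.2 a⟩ : Subgroup.center G)) := by
    rintro ⟨c', hc'⟩
    obtain ⟨h, hh⟩ := key hC (d := fun g => pw c.1 (f g)) hw' hne hc'
    exact ⟨f h, Subtype.ext hh⟩
  have hle := Nat.card_le_card_of_surjective _ hsurj
  rw [Nat.card_zmod] at hle
  have hdvd : p ∣ Nat.card (Subgroup.center G) :=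
    (hp.to_subgroup _).card_eq_or_dvd.resolve_left
      (fun h => hC.1 (Subgroup.eq_bot_of_card_eq _ h))
  exact hcard (le_antisymm hle (Nat.le_of_dvd Nat.card_pos hdvd))

end CaminaAux

/-- If `G` is a finite `p`-group such that `(G, Z(G))` is a Camina pair, then
`|G|` divides `|Aut G|`. -/
theorem card_dvd_card_mulAut_of_caminaPair {p : ℕ} [Fact p.Prime] {G : Type*} [Group G]
    [Finite G] (hp : IsPGroup p G) (hC : IsCaminaPairCenter G) :
    Nat.card G ∣ Nat.card (MulAut G) := by
  apply CaminaAux.dvd_of_out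
  by_cases hcard : Nat.card (Subgroup.center G) = p
  · rw [hcard]
    by_contra h
    exact CaminaAux.card_p_case hp hC hcard
      (fun d h1 h2 => CaminaAux.inner_of_not_dvd hp h d h1 h2)
  · exact CaminaAux.card_ne_case hp hC hcard
end

section
/- Let G be a finite Camina p-group. Then |G| divides |Aut(G)|. -/
/-- `G` is a Camina group: `(G, G')` is a Camina pair, i.e. `G'` is a nontrivial proper
subgroup and `x * G' ⊆ xᴳ` for every `x ∈ G \ G'`. -/
def IsCaminaGroup (G : Type*) [Group G] : Prop :=
  commutator G ≠ ⊥ ∧ commutator G ≠ ⊤ ∧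
    ∀ x : G, x ∉ commutator G → ∀ z ∈ commutator G, IsConj x (x * z)

namespace Camina
open Subgroup commutatorElement

lemma ker_conj (G : Type*) [Group G] : (MulAut.conj : G →* MulAut G).ker = center G := by
  ext x
  simp only [MonoidHom.mem_ker, mem_center_iff, MulEquiv.ext_iff, MulAut.conj_apply, MulAut.one_apply]
  refine forall_congr' fun g => ?_
  rw [mul_inv_eq_iff_eq_mul, eq_comm]

lemma card_eq_mul_of_le {G : Type*} [Group G] {H K : Subgroup G} (h : H ≤ K) :
    Nat.card K = Nat.card H * H.relIndex K := by
  have := relIndex_mul_relIndex ⊥ H K bot_le h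
  rw [relIndex_bot_left, relIndex_bot_left] at this
  exact this.symm

lemma card_comap_conj {G : Type*} [Group G] (A : Subgroup (MulAut G)) :
    Nat.card (A.comap MulAut.conj) =
      Nat.card (center G) * Nat.card ((MulAut.conj : G →* MulAut G).range ⊓ A : Subgroup _) := by
  have hle : center G ≤ A.comap MulAut.conj := by
    rw [← ker_conj]; exact ker_le_comap _ _
  rw [card_eq_mul_of_le hle, ← ker_conj, relIndex_ker, map_comap_eq]

instance conj_range_normal (G : Type*) [Group G] :
    ((MulAut.conj : G →* MulAut G).range).Normal := by
  constructor
  rintro _ ⟨g, rfl⟩ f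
  refine ⟨f g, ?_⟩
  ext x
  simp [MulAut.conj_apply]

lemma card_dvd_of_relIndex {p : ℕ} [Fact p.Prime] {G : Type*} [Group G] [Finite G]
    (hp : IsPGroup p G) (A : Subgroup (MulAut G)) (hA : IsPGroup p A)
    (h : Nat.card (center G) ≤ (MulAut.conj : G →* MulAut G).range.relIndex A) :
    Nat.card G ∣ Nat.card (MulAut G) := by
  have hpp : p.Prime := Fact.out
  set I := (MulAut.conj : G →* MulAut G).range with hI
  have h1 : Nat.card G = Nat.card (center G) * Nat.card I := by
    rw [← card_mul_index (center G), ← ker_conj, index_ker]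
  have h2 : Nat.card (A ⊔ I : Subgroup _) = Nat.card I * I.relIndex A := by
    rw [card_eq_mul_of_le (le_sup_right : I ≤ A ⊔ I), relIndex_sup_right]
  obtain ⟨a, ha⟩ := (hp.to_subgroup (center G)).exists_card_eq
  obtain ⟨b, hb⟩ := hA.exists_card_eq
  obtain ⟨c, -, hc⟩ := (Nat.dvd_prime_pow hpp).1 (hb ▸ relIndex_dvd_card I A)
  rw [ha, hc] at h
  have hac : a ≤ c := (Nat.pow_le_pow_iff_right hpp.one_lt).1 h
  refine dvd_trans ?_ (card_subgroup_dvd_card (A ⊔ I))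
  rw [h1, h2, ha, hc, mul_comm]
  exact mul_dvd_mul_left _ (pow_dvd_pow p hac)

/-- commuting powers -/
lemma pow_comm_rel {G : Type*} [Group G] {g h c : G} (hc : c ∈ center G) (e : g * h = h * g * c)
    (n : ℕ) : g ^ n * h = h * g ^ n * c ^ n := by
  have hg : ∀ m : ℕ, ∀ y, c ^ m * y = y * c ^ m := fun m y =>
    (mem_center_iff.1 (pow_mem hc m) y).symm
  induction n with
  | zero => simp
  | succ n ih =>
    calc g ^ (n+1) * h = g ^ n * (g * h) := by rw [pow_succ, mul_assoc]
      _ = (g ^ n * h) * g * c := by rw [e]; group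
      _ = h * g ^ n * (c ^ n * g) * c := by rw [ih]; group
      _ = h * g ^ n * (g * c ^ n) * c := by rw [hg]
      _ = _ := by rw [pow_succ g, pow_succ c]; group

lemma mul_pow_rel {G : Type*} [Group G] {g h c : G} (hc : c ∈ center G) (e : g * h = h * g * c)
    (n : ℕ) : (h * g) ^ n = h ^ n * g ^ n * c ^ (n.choose 2) := by
  have hg : ∀ m : ℕ, ∀ y, c ^ m * y = y * c ^ m := fun m y =>
    (mem_center_iff.1 (pow_mem hc m) y).symm
  induction n with
  | zero => simp
  | succ n ih =>
    calc (h * g) ^ (n+1) = h ^ n * g ^ n * (c ^ (n.choose 2) * (h * g)) := by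
          rw [pow_succ, ih]; group
      _ = h ^ n * (g ^ n * h) * g * c ^ (n.choose 2) := by rw [hg]; group
      _ = h ^ n * h * g ^ n * (c ^ n * g) * c ^ (n.choose 2) := by
          rw [pow_comm_rel hc e]; simp only [mul_assoc]
      _ = h ^ (n+1) * g ^ (n+1) * (c ^ n * c ^ (n.choose 2)) := by
          rw [hg, pow_succ, pow_succ]; simp only [mul_assoc]
      _ = _ := by rw [← pow_add, Nat.choose_succ_succ' n 1, Nat.choose_one_right]

lemma center_le {G : Type*} [Group G] (hC : IsCaminaGroup G) : center G ≤ commutator G := by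
  intro x hx
  by_contra hn
  apply hC.1
  rw [eq_bot_iff]
  intro z hz
  obtain ⟨g, hg⟩ := isConj_iff.1 (hC.2.2 x hn z hz)
  rw [mem_center_iff.1 hx g] at hg
  simpa using hg.symm

lemma commutator_lt {G : Type*} [Group G] [Group.IsNilpotent G] (h : commutator G ≠ ⊥) :
    ¬ commutator G ≤ ⁅commutator G, (⊤ : Subgroup G)⁆ := by
  intro hle
  have key : ∀ n, commutator G ≤ (⊤ : Subgroup G).lowerCentralSeries n := by
    intro n
    induction n with
    | zero => simp
    | succ n ih =>
      rw [Subgroup.lowerCentralSeries_succ]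
      exact hle.trans (commutator_mono ih le_rfl)
  obtain ⟨n, hn⟩ := Subgroup.nilpotent_iff_lowerCentralSeries.1 (inferInstance : Group.IsNilpotent G)
  exact h (le_bot_iff.1 (hn ▸ key n))

/-- the abelianization has exponent `p`. -/
lemma pow_mem_commutator {p : ℕ} [Fact p.Prime] {G : Type*} [Group G] [Finite G]
    (hp : IsPGroup p G) (hC : IsCaminaGroup G) (x : G) : x ^ p ∈ commutator G := by
  by_contra hx
  have := hp.isNilpotent
  set M : Subgroup G := ⁅commutator G, (⊤ : Subgroup G)⁆ with hM
  let q := QuotientGroup.mk' M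
  have hcen : ∀ z ∈ commutator G, q z ∈ center (G ⧸ M) := by
    intro z hz
    rw [mem_center_iff]
    intro y
    obtain ⟨y, rfl⟩ := QuotientGroup.mk'_surjective M y
    have : ⁅z, y⁆ ∈ M := commutator_mem_commutator hz (mem_top y)
    have h1 : q ⁅z, y⁆ = 1 := (QuotientGroup.eq_one_iff _).2 this
    rw [map_commutatorElement, commutatorElement_eq_one_iff_mul_comm] at h1
    exact h1.symm
  -- the p-power map on the image of the derived subgroup
  let K : Subgroup (G ⧸ M) := (commutator G).map q
  have hsurj : ∀ k : K, ∃ l : K, l ^ p = k := by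
    rintro ⟨_, z, hz, rfl⟩
    obtain ⟨g, hg⟩ := isConj_iff.1 (hC.2.2 (x ^ p) hx z hz)
    have hc : x⁻¹ * g * x * g⁻¹ ∈ commutator G := by
      have := commutator_mem_commutator (mem_top x⁻¹) (mem_top g)
      rw [commutatorElement_def, inv_inv] at this
      exact this
    refine ⟨⟨q (x⁻¹ * g * x * g⁻¹), mem_map_of_mem _ hc⟩, ?_⟩
    ext
    have hcc := hcen _ hc
    set c := q (x⁻¹ * g * x * g⁻¹) with hcdef
    have hgx : q g * q x * (q g)⁻¹ = q x * c := by
      rw [hcdef, ← map_inv, ← map_mul, ← map_mul, ← map_mul]; congr 1; group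
    have hgx2 : (q g * q x * (q g)⁻¹) ^ p = q x ^ p * q z := by
      rw [← map_inv, ← map_mul, ← map_mul, ← map_pow, ← map_pow, ← map_mul]
      congr 1
      rw [← hg, conj_pow]
    rw [hgx, (show Commute (q x) c from mem_center_iff.1 hcc (q x)).mul_pow] at hgx2
    exact mul_left_cancel hgx2
  have hinj : Function.Injective (fun l : K => l ^ p) :=
    Finite.injective_iff_surjective.2 hsurj
  have hK : IsPGroup p K := (hp.to_quotient M).to_subgroup K
  have htriv : ∀ k : K, k = 1 := by
    intro k
    obtain ⟨n, hn⟩ := hK k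
    induction n with
    | zero => simpa using hn
    | succ n ih =>
      apply ih
      apply hinj
      simpa [← pow_mul, pow_succ] using hn
  apply commutator_lt hC.1
  intro z hz
  have := htriv ⟨q z, mem_map_of_mem _ hz⟩
  exact (QuotientGroup.eq_one_iff _).1 (congrArg Subtype.val this)


/-- Central automorphisms coming from homomorphisms to a central subgroup. -/
def caut {G C : Type*} [Group G] [CommGroup C] (i : C →* G) (hi : ∀ c, i c ∈ center G)
    (hi' : ∀ c, i c ∈ commutator G) : (G →* C) →* MulAut G :=
  have hk : ∀ (f : G →* C) c, f (i c) = 1 := fun f c => Abelianization.commutator_subset_ker f (hi' c)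
  have hz : ∀ c y, i c * y = y * i c := fun c y => (mem_center_iff.1 (hi c) y).symm
  { toFun := fun f =>
      { toFun := fun g => g * i (f g)
        invFun := fun g => g * i (f g)⁻¹
        left_inv := fun g => by simp [hk]
        right_inv := fun g => by
          have h2 : ∀ c, f (i c)⁻¹ = 1 := fun c => by simp [hk]
          simp [hk]
        map_mul' := fun g h => by
          rw [map_mul, map_mul]
          calc g * h * (i (f g) * i (f h)) = g * (h * i (f g)) * i (f h) := by group
            _ = g * (i (f g) * h) * i (f h) := by rw [hz]
            _ = _ := by group }
    map_one' := by ext g; simp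
    map_mul' := fun f1 f2 => by
      ext g
      change g * i ((f1 * f2) g) = g * i (f2 g) * i (f1 (g * i (f2 g)))
      rw [MonoidHom.mul_apply, map_mul, map_mul f1, hk, mul_one, hz, mul_assoc] }

lemma caut_apply {G C : Type*} [Group G] [CommGroup C] (i : C →* G) (hi : ∀ c, i c ∈ center G)
    (hi' : ∀ c, i c ∈ commutator G) (f : G →* C) (g : G) : caut i hi hi' f g = g * i (f g) := rfl

lemma card_dual {p : ℕ} [Fact p.Prime] {V : Type*} [AddCommGroup V] [Module (ZMod p) V]
    [Finite V] : Nat.card (Module.Dual (ZMod p) V) = Nat.card V := by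
  have : Finite (Module.Dual (ZMod p) V) := Module.finite_of_finite (ZMod p)
  rw [Module.natCard_eq_pow_finrank (K := ZMod p) (V := Module.Dual (ZMod p) V),
    Subspace.dual_finrank_eq, ← Module.natCard_eq_pow_finrank (K := ZMod p)]

lemma card_hom {p : ℕ} [Fact p.Prime] {G : Type*} [Group G] [Finite G]
    (h : ∀ x : G, x ^ p ∈ commutator G) :
    Nat.card (G →* Multiplicative (ZMod p)) = Nat.card (G ⧸ commutator G) := by
  let V := Additive (Abelianization G)
  have hV : ∀ v : V, p • v = 0 := by
    intro v
    obtain ⟨x, rfl⟩ := QuotientGroup.mk_surjective (Additive.toMul v)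
    exact (QuotientGroup.eq_one_iff _).2 (h x)
  let _ : Module (ZMod p) V := AddCommGroup.zmodModule hV
  have : Finite V := inferInstanceAs (Finite (G ⧸ commutator G))
  have e1 : Nat.card (G →* Multiplicative (ZMod p)) = Nat.card (Module.Dual (ZMod p) V) := by
    refine Nat.card_congr ?_
    refine (Abelianization.lift (A := Multiplicative (ZMod p))).trans ?_
    refine (MonoidHom.toAdditiveLeft).trans ?_
    exact (AddMonoidHom.toZModLinearMapEquiv p).toEquiv
  rw [e1]
  exact card_dual

/-- Elements commuting with `x` modulo the central subgroup `P`. -/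
def cmod {G : Type*} [Group G] (x : G) (P : Subgroup G) (hP : P ≤ center G) : Subgroup G where
  carrier := {d | ∃ u ∈ P, d * x * d⁻¹ = x * u}
  one_mem' := ⟨1, one_mem _, by simp⟩
  mul_mem' := by
    rintro a b ⟨u, hu, ha⟩ ⟨v, hv, hb⟩
    refine ⟨u * v, mul_mem hu hv, ?_⟩
    have hc := mem_center_iff.1 (hP hv)
    calc a * b * x * (a * b)⁻¹ = a * (b * x * b⁻¹) * a⁻¹ := by group
      _ = a * x * (v * a⁻¹) := by rw [hb]; group
      _ = (a * x * a⁻¹) * v := by rw [← hc]; group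
      _ = _ := by rw [ha, mul_assoc]
  inv_mem' := by
    rintro a ⟨u, hu, ha⟩
    refine ⟨u⁻¹, inv_mem hu, ?_⟩
    have hc := mem_center_iff.1 (hP (inv_mem hu))
    have : x = a⁻¹ * (x * u) * a := by rw [← ha]; group
    calc a⁻¹ * x * a⁻¹⁻¹ = a⁻¹ * (x * u) * (u⁻¹ * a) := by group
      _ = a⁻¹ * (x * u) * a * u⁻¹ := by rw [← hc]; group
      _ = _ := by rw [← this]

lemma card_cmod {G : Type*} [Group G] [Finite G] (hC : IsCaminaGroup G) {x : G}
    (hx : x ∉ commutator G) (P : Subgroup G) (hP : P ≤ center G) :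
    Nat.card (cmod x P hP) * Nat.card (commutator G) ≤ Nat.card G * Nat.card P := by
  have h1 : ∀ z : commutator G, ∃ g : G, g * x * g⁻¹ = x * z := fun z =>
    isConj_iff.1 (hC.2.2 x hx z z.2)
  choose t ht using h1
  have h2 : ∀ d : cmod x P hP, ∃ u : P, (d : G) * x * (d : G)⁻¹ = x * u := by
    rintro ⟨d, u, hu, h⟩
    exact ⟨⟨u, hu⟩, h⟩
  choose u hu using h2
  rw [← Nat.card_prod, ← Nat.card_prod]
  refine Nat.card_le_card_of_injective
    (fun a : cmod x P hP × commutator G => ((t a.2 * a.1 : G), u a.1)) ?_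
  have key : ∀ (d : cmod x P hP) z, (t z * d) * x * (t z * d : G)⁻¹ = x * z * u d := by
    intro d z
    have hc := mem_center_iff.1 (hP (u d).2)
    calc (t z * d) * x * (t z * d : G)⁻¹ = t z * (d * x * (d : G)⁻¹) * (t z)⁻¹ := by group
      _ = t z * x * (u d * (t z)⁻¹) := by rw [hu]; group
      _ = (t z * x * (t z)⁻¹) * u d := by rw [← hc]; group
      _ = _ := by rw [ht]
  rintro ⟨d, z⟩ ⟨d', z'⟩ h
  simp only [Prod.mk.injEq] at h
  have k1 := key d z
  rw [h.1, h.2, key d' z'] at k1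
  have hz : z' = z := by
    ext
    simpa using k1
  subst hz
  have : d = d' := by
    ext
    simpa using h.1
  rw [this]

lemma case_one {p : ℕ} [Fact p.Prime] {G : Type*} [Group G]
    [Finite G] (hp : IsPGroup p G) (hC : IsCaminaGroup G) (P : Subgroup G) (hP : P ≤ center G)
    (hcard : Nat.card P = p) (hne : ¬ commutator G ≤ P) :
    Nat.card G ∣ Nat.card (MulAut G) := by
  have hpp : p.Prime := Fact.out
  have hC' : Nat.card (Multiplicative (ZMod p)) = p := by simp
  let e : Multiplicative (ZMod p) ≃* P := mulEquivOfPrimeCardEq hC' hcard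
  let i : Multiplicative (ZMod p) →* G := P.subtype.comp e.toMonoidHom
  have hiP : ∀ c, i c ∈ P := fun c => (e c).2
  have hinj : Function.Injective i := fun a b h => e.injective (Subtype.ext h)
  let F := caut i (fun c => hP (hiP c)) (fun c => center_le hC (hP (hiP c)))
  have hFinj : Function.Injective F := by
    intro f g h
    ext x : 1
    have : x * i (f x) = x * i (g x) := congrArg (fun a : MulAut G => a x) h
    exact hinj (mul_left_cancel this)
  have hA : IsPGroup p F.range := by
    rintro ⟨_, f, rfl⟩
    refine ⟨1, ?_⟩
    ext x : 2
    have : f ^ p = 1 := by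
      ext x : 1
      have := pow_card_eq_one' (x := f x)
      rw [hC'] at this
      simpa using this
    simp [← map_pow, this]
  have hAcard : Nat.card F.range = Nat.card (G ⧸ commutator G) := by
    rw [← card_hom (pow_mem_commutator hp hC)]
    exact Nat.card_range_of_injective hFinj
  obtain ⟨x, hx⟩ : ∃ x, x ∉ commutator G := by
    by_contra! h
    exact hC.2.1 (eq_top_iff.2 fun x _ => h x)
  set W := F.range.comap MulAut.conj with hW
  have hWP : ∀ w ∈ W, ∀ g, ∃ u ∈ P, w * g * w⁻¹ = g * u := by
    rintro w ⟨f, hf⟩ g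
    refine ⟨i (f g), hiP _, ?_⟩
    rw [← MulAut.conj_apply, ← hf]
    rfl
  have hWle : W ≤ cmod x P hP := fun w hw => hWP w hw x
  have hxD : x ∈ cmod x P hP := ⟨1, one_mem _, by simp⟩
  have hxW : x ∉ W := by
    intro hxW
    apply hne
    intro z hz
    obtain ⟨g, hg⟩ := isConj_iff.1 (hC.2.2 x hx z hz)
    obtain ⟨u, hu, h⟩ := hWP _ (inv_mem hxW) g
    have hc := mem_center_iff.1 (hP hu) g
    have : z = u := by
      calc z = x⁻¹ * (x * z) := by group
        _ = (x⁻¹ * g * x⁻¹⁻¹) * g⁻¹ := by rw [← hg]; group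
        _ = u := by rw [h, hc]; group
    rwa [this]
  have hWcard : Nat.card W * p ≤ Nat.card (cmod x P hP) := by
    rw [card_eq_mul_of_le hWle]
    refine Nat.mul_le_mul_left _ ?_
    obtain ⟨b, hb⟩ := (hp.to_subgroup (cmod x P hP)).exists_card_eq
    obtain ⟨c, -, hc⟩ := (Nat.dvd_prime_pow hpp).1 (hb ▸ relIndex_dvd_card W (cmod x P hP))
    rw [hc]
    have : c ≠ 0 := by
      rintro rfl
      rw [pow_zero, relIndex_eq_one] at hc
      exact hxW (hc hxD)
    exact Nat.le_self_pow this p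
  have hDcard := card_cmod hC hx P hP
  rw [hcard] at hDcard
  have hG : Nat.card G = Nat.card (G ⧸ commutator G) * Nat.card (commutator G) :=
    card_eq_card_quotient_mul_card_subgroup _
  have hWfin : Nat.card W ≤ Nat.card F.range := by
    rw [hAcard]
    have h3 : Nat.card W * (p * Nat.card (commutator G)) ≤
        Nat.card (G ⧸ commutator G) * (p * Nat.card (commutator G)) := by
      calc _ = Nat.card W * p * Nat.card (commutator G) := by ring
        _ ≤ _ := Nat.mul_le_mul_right _ hWcard
        _ ≤ _ := hDcard
        _ = _ := by rw [hG]; ring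
    exact Nat.le_of_mul_le_mul_right h3 (Nat.mul_pos hpp.pos Nat.card_pos)
  apply card_dvd_of_relIndex hp F.range hA
  rw [hW, card_comap_conj] at hWfin
  rw [card_eq_mul_of_le (inf_le_right : (MulAut.conj : G →* MulAut G).range ⊓ F.range ≤ F.range),
    inf_relIndex_right, mul_comm] at hWfin
  exact Nat.le_of_mul_le_mul_left hWfin Nat.card_pos

/-- class two case with derived subgroup equal to the centre, of order `p`: a suitable element. -/
lemma exists_elt {p : ℕ} [Fact p.Prime] {G : Type*} [Group G] [Finite G]
    (hne : ∃ x y : G, x * y ≠ y * x) (P : Subgroup G) (hP : P = center G)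
    (hcard : Nat.card P = p) (hcomm : ∀ x y : G, ∃ c ∈ P, x * y = y * x * c) :
    ∃ a z : G, a ∉ P ∧ z ∈ P ∧ z ≠ 1 ∧ a ^ p = z ^ (p.choose 2) := by
  have hpp : p.Prime := Fact.out
  have hPp : ∀ c ∈ P, c ^ p = 1 := by
    intro c hc
    have := pow_card_eq_one' (x := (⟨c, hc⟩ : P))
    rw [hcard] at this
    exact congrArg Subtype.val this
  have hpow : ∀ x : G, x ^ p ∈ P := by
    intro x
    rw [hP, mem_center_iff]
    intro y
    obtain ⟨c, hc, h⟩ := hcomm x y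
    have := pow_comm_rel (hP ▸ hc) h p
    rw [hPp c hc, mul_one] at this
    exact this.symm
  have hgen : ∀ z ∈ P, z ≠ 1 → ∀ c ∈ P, ∃ k : ℕ, c = z ^ k := by
    intro z hz hz1 c hc
    have := mem_powers_of_prime_card (g := (⟨z, hz⟩ : P)) (g' := ⟨c, hc⟩) hcard
      (fun h => hz1 (congrArg Subtype.val h))
    obtain ⟨k, hk⟩ := this
    exact ⟨k, (congrArg Subtype.val hk).symm⟩
  rcases hpp.eq_two_or_odd' with rfl | hodd
  · by_contra! hcon
    have hsq : ∀ a : G, a ^ 2 = 1 := by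
      intro a
      by_contra ha
      refine hcon a (a ^ 2) ?_ (hpow a) ha (by simp)
      intro haP
      exact ha (hPp a haP)
    obtain ⟨x, y, hxy⟩ := hne
    apply hxy
    have h1 := hsq (x * y)
    have hx := hsq x
    have hy := hsq y
    have hx' : x⁻¹ = x := by rw [inv_eq_iff_mul_eq_one, ← sq, hx]
    have hy' : y⁻¹ = y := by rw [inv_eq_iff_mul_eq_one, ← sq, hy]
    have hxy' : (x * y)⁻¹ = x * y := by rw [inv_eq_iff_mul_eq_one, ← sq, h1]
    rw [mul_inv_rev, hx', hy'] at hxy'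
    exact hxy'.symm
  · have hdvd : p ∣ p.choose 2 := by
      refine hpp.dvd_choose_self (by norm_num) ?_
      obtain ⟨k, hk⟩ := hodd
      have := hpp.two_le
      omega
    have hch : ∀ c ∈ P, c ^ (p.choose 2) = 1 := by
      intro c hc
      obtain ⟨k, hk⟩ := hdvd
      rw [hk, pow_mul, hPp c hc, one_pow]
    have hnt : ∃ z ∈ P, z ≠ 1 := by
      have : Nontrivial P := Finite.one_lt_card_iff_nontrivial.1 (hcard ▸ hpp.one_lt)
      obtain ⟨z, hz⟩ := exists_ne (1 : P)
      exact ⟨z, z.2, fun h => hz (Subtype.ext h)⟩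
    obtain ⟨z, hz, hz1⟩ := hnt
    suffices ∃ a : G, a ∉ P ∧ a ^ p = 1 by
      obtain ⟨a, ha, hap⟩ := this
      exact ⟨a, z, ha, hz, hz1, by rw [hap, hch z hz]⟩
    obtain ⟨x, y, hxy⟩ := hne
    by_cases hx : x ^ p = 1
    · refine ⟨x, ?_, hx⟩
      intro hxP
      rw [hP, mem_center_iff] at hxP
      exact hxy (hxP y).symm
    · obtain ⟨k, hk⟩ := hgen _ (hpow x) hx _ (inv_mem (hpow y))
      refine ⟨y * x ^ k, ?_, ?_⟩
      · intro h
        rw [hP, mem_center_iff] at h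
        apply hxy
        have h1 := h x
        have h2 : x * y * x ^ k = y * x * x ^ k := by
          rw [mul_assoc, h1, mul_assoc, mul_assoc, ← pow_succ, ← pow_succ']
        exact mul_right_cancel h2
      · obtain ⟨c, hc, h⟩ := hcomm (x ^ k) y
        rw [mul_pow_rel (hP ▸ hc) h, hch c hc, mul_one, ← pow_mul, mul_comm k p, pow_mul, ← hk]
        group

lemma case_two {p : ℕ} [Fact p.Prime] {G : Type*} [Group G]
    [Finite G] (hp : IsPGroup p G) (hne : ∃ x y : G, x * y ≠ y * x) (P : Subgroup G)
    (hP : P = center G) (hcard : Nat.card P = p)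
    (hcomm : ∀ x y : G, ∃ c ∈ P, x * y = y * x * c) :
    Nat.card G ∣ Nat.card (MulAut G) := by
  have hpp : p.Prime := Fact.out
  obtain ⟨a, z, ha, hz, hz1, haz⟩ := exists_elt hne P hP hcard hcomm
  have hgen : ∀ z ∈ P, z ≠ 1 → ∀ c ∈ P, ∃ k : ℕ, c = z ^ k := by
    intro z hz hz1 c hc
    have := mem_powers_of_prime_card (g := (⟨z, hz⟩ : P)) (g' := ⟨c, hc⟩) hcard
      (fun h => hz1 (congrArg Subtype.val h))
    obtain ⟨k, hk⟩ := this
    exact ⟨k, (congrArg Subtype.val hk).symm⟩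
  have hordz : orderOf z = p := by
    refine orderOf_eq_prime ?_ hz1
    have := pow_card_eq_one' (x := (⟨z, hz⟩ : P))
    rw [hcard] at this
    exact congrArg Subtype.val this
  set y := z⁻¹ with hy
  have hyP : y ∈ P := inv_mem hz
  have hordy : orderOf y = p := by rw [hy, orderOf_inv, hordz]
  have hyc : ∀ (m : ℕ) g, y ^ m * g = g * y ^ m := fun m g =>
    (mem_center_iff.1 (hP ▸ pow_mem hyP m) g).symm
  have hy1 : y ≠ 1 := by simpa [hy] using hz1
  let θ : ℕ → G := fun k => a ^ k * y ^ (k.choose 2)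
  have hθadd : ∀ k l, θ (k + l) = θ k * θ l * y ^ (k * l) := by
    intro k l
    have hch : (k + l).choose 2 = k.choose 2 + l.choose 2 + k * l := by
      rw [Nat.add_choose_eq]
      simp [Finset.Nat.antidiagonal_succ]
      ring
    simp only [θ]
    rw [hch, pow_add, pow_add, pow_add]
    calc _ = a ^ k * (a ^ l * y ^ (k.choose 2)) * y ^ (l.choose 2) * y ^ (k * l) := by
            simp only [mul_assoc]
      _ = _ := by rw [← hyc (k.choose 2)]; simp only [mul_assoc]
  have hθp : θ p = 1 := by
    simp only [θ]
    rw [haz, hy, inv_pow, mul_inv_cancel]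
  have hyp : ∀ k, y ^ (k * p) = 1 := fun k => by
    rw [mul_comm, pow_mul, ← hordy, pow_orderOf_eq_one, one_pow]
  have hθper : ∀ k, θ (k + p) = θ k := by
    intro k
    rw [hθadd, hθp, mul_one, hyp, mul_one]
  have hθmod : ∀ k, θ (k % p) = θ k := by
    intro k
    exact Function.Periodic.map_mod_nat hθper k
  have hθeq : ∀ k l, y ^ k = y ^ l → θ k = θ l := by
    intro k l h
    rw [pow_eq_pow_iff_modEq, hordy] at h
    rw [← hθmod k, ← hθmod l, h]
  -- exponent function
  have hk : ∀ g, ∃ k : ℕ, a * g = g * a * y ^ k := by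
    intro g
    obtain ⟨c, hc, h⟩ := hcomm a g
    obtain ⟨k, rfl⟩ := hgen y hyP hy1 c hc
    exact ⟨k, h⟩
  choose k hk using hk
  have hθg : ∀ m g, θ m * g = g * θ m * y ^ (m * k g) := by
    intro m g
    have := pow_comm_rel (hP ▸ pow_mem hyP (k g)) (hk g) m
    simp only [θ]
    rw [mul_assoc, hyc, ← mul_assoc, this, ← pow_mul, mul_comm m, mul_assoc, hyc]
    simp only [mul_assoc]
  have hkadd : ∀ g h, y ^ k (g * h) = y ^ (k g + k h) := by
    intro g h
    have h1 : a * (g * h) = g * h * a * y ^ (k g + k h) := by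
      rw [← mul_assoc, hk g, mul_assoc, hyc, ← mul_assoc, mul_assoc g, hk h, pow_add, hyc]
      simp only [mul_assoc]
    rw [hk] at h1
    exact mul_left_cancel h1
  have hka : ∀ m, y ^ k (θ m) = 1 := by
    intro m
    have h1 : a * θ m = θ m * a := by
      simp only [θ]
      rw [mul_assoc, hyc, ← mul_assoc, ← mul_assoc, (Commute.self_pow a m).eq]
    rw [hk, mul_eq_left] at h1
    exact h1
  let φ : G →* G := MonoidHom.mk' (fun g => g * θ (k g)) (by
    intro g h
    rw [hθeq _ _ (hkadd g h), hθadd]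
    calc _ = g * (h * θ (k g) * (θ (k h) * y ^ (k g * k h))) := by simp only [mul_assoc]
      _ = g * (h * θ (k g) * y ^ (k g * k h)) * θ (k h) := by
        rw [← hyc]; simp only [mul_assoc]
      _ = _ := by rw [← hθg]; simp only [mul_assoc])
  have hφ : ∀ g, φ g = g * θ (k g) := fun g => rfl
  have hθ0 : θ 0 = 1 := by simp [θ]
  have hkθ : ∀ m, θ (k (θ m)) = 1 := by
    intro m
    rw [hθeq _ 0 (by rw [hka, pow_zero]), hθ0]
  have hφθ : ∀ m, φ (θ m) = θ m := by
    intro m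
    rw [hφ, hkθ, mul_one]
  have hinj : Function.Injective φ := by
    rw [injective_iff_map_eq_one]
    intro g hg
    have h1 := hg
    have h2 : φ (g * θ (k g)) = 1 := by rw [← hφ, hg, map_one]
    rw [map_mul, hφθ, hg, one_mul] at h2
    rw [hφ, h2, mul_one] at h1
    exact h1
  let ψ : MulAut G := MulEquiv.ofBijective φ (Finite.injective_iff_bijective.1 hinj)
  have hψ : ∀ g, ψ g = g * θ (k g) := fun g => rfl
  have hψpow : ∀ n : ℕ, ∀ g, (ψ ^ n) g = g * θ (k g) ^ n := by
    intro n
    induction n with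
    | zero => simp
    | succ n ih =>
      intro g
      have : ψ (θ (k g)) = θ (k g) := hφθ _
      rw [pow_succ', MulAut.mul_apply, ih, map_mul, map_pow, this, hψ, pow_succ', mul_assoc]
  obtain ⟨N, hN⟩ := hp.exists_card_eq
  have hψord : ψ ^ p ^ N = 1 := by
    ext g
    rw [hψpow, ← hN, pow_card_eq_one', mul_one, MulAut.one_apply]
  have hA : IsPGroup p (zpowers ψ) := by
    rintro ⟨t, ht⟩
    obtain ⟨m, rfl⟩ := mem_zpowers_iff.1 ht
    refine ⟨N, Subtype.ext ?_⟩
    change (ψ ^ m) ^ p ^ N = 1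
    rw [← zpow_natCast, ← zpow_mul, mul_comm, zpow_mul, zpow_natCast, hψord, one_zpow]
  have hnot : ψ ∉ (MulAut.conj : G →* MulAut G).range := by
    rintro ⟨h, hh⟩
    obtain ⟨b, hb⟩ : ∃ b, a * b ≠ b * a := by
      by_contra! hcon
      apply ha
      rw [hP, mem_center_iff]
      exact fun g => (hcon g).symm
    -- all values θ (k g) lie in P
    have hin : ∀ g, θ (k g) ∈ P := by
      intro g
      obtain ⟨c, hc, e⟩ := hcomm h g
      have h1 : ψ g = g * c := by
        rw [← hh, MulAut.conj_apply, e, mul_assoc, mul_assoc,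
          ← mem_center_iff.1 (hP ▸ hc) h⁻¹]
        group
      rw [hψ] at h1
      rw [mul_left_cancel h1]
      exact hc
    have hin2 : a ^ k b ∈ P := by
      have := hin b
      simp only [θ] at this
      exact (mul_mem_cancel_right (pow_mem hyP _)).1 this
    have hap : a ^ p ∈ P := haz ▸ pow_mem hz _
    have hcop : Nat.Coprime (k b) p := by
      rw [Nat.coprime_comm, hpp.coprime_iff_not_dvd]
      rintro ⟨m, hm⟩
      apply hb
      rw [hk, hm, mul_comm, hyp, mul_one]
    apply ha
    have hbez := Nat.gcd_eq_gcd_ab (k b) p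
    rw [hcop] at hbez
    have : a = (a ^ k b) ^ (Nat.gcdA (k b) p) * (a ^ p) ^ (Nat.gcdB (k b) p) := by
      rw [← zpow_natCast, ← zpow_natCast, ← zpow_mul, ← zpow_mul, ← zpow_add, ← hbez]
      simp
    rw [this]
    exact mul_mem (zpow_mem hin2 _) (zpow_mem hap _)
  apply card_dvd_of_relIndex hp (zpowers ψ) hA
  rw [← hP, hcard]
  obtain ⟨b, hb⟩ := hA.exists_card_eq
  obtain ⟨c, -, hc⟩ := (Nat.dvd_prime_pow hpp).1
    (hb ▸ relIndex_dvd_card (MulAut.conj : G →* MulAut G).range (zpowers ψ))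
  rw [hc]
  have : c ≠ 0 := by
    rintro rfl
    rw [pow_zero, relIndex_eq_one] at hc
    exact hnot (hc (mem_zpowers ψ))
  exact Nat.le_self_pow this p

end Camina

/-- If `G` is a finite Camina `p`-group, then `|G|` divides `|Aut G|`. -/
theorem card_dvd_card_mulAut_of_camina {p : ℕ} [Fact p.Prime] {G : Type*} [Group G]
    [Finite G] (hp : IsPGroup p G) (hC : IsCaminaGroup G) :
    Nat.card G ∣ Nat.card (MulAut G) := by
  have hpp : p.Prime := Fact.out
  have hnt : Nontrivial G := by
    by_contra h
    rw [not_nontrivial_iff_subsingleton] at h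
    exact hC.1 (Subsingleton.elim _ _)
  have hcn : Nontrivial (Subgroup.center G) := hp.center_nontrivial
  have hdvd : p ∣ Nat.card (Subgroup.center G) := by
    obtain ⟨n, hn0, hn⟩ := (hp.to_subgroup (Subgroup.center G)).nontrivial_iff_card.1 hcn
    rw [hn]
    exact dvd_pow_self p hn0.ne'
  obtain ⟨z, hz⟩ := exists_prime_orderOf_dvd_card' p hdvd
  let P : Subgroup G := Subgroup.zpowers (z : G)
  have hcard : Nat.card P = p := by
    rw [Nat.card_zpowers, Subgroup.orderOf_coe, hz]
  have hPc : P ≤ Subgroup.center G := by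
    rw [Subgroup.zpowers_le]
    exact z.2
  by_cases hle : commutator G ≤ P
  · have hP : P = Subgroup.center G :=
      le_antisymm hPc ((Camina.center_le hC).trans hle)
    refine Camina.case_two hp ?_ P hP hcard ?_
    · by_contra! hcon
      apply hC.1
      rw [commutator_eq_bot_iff_center_eq_top, eq_top_iff]
      intro x _
      rw [Subgroup.mem_center_iff]
      exact fun g => hcon g x
    · intro x y
      refine ⟨x⁻¹ * y⁻¹ * x * y, hle ?_, by group⟩
      have := Subgroup.commutator_mem_commutator (Subgroup.mem_top x⁻¹) (Subgroup.mem_top y⁻¹)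
      rw [commutatorElement_def, inv_inv, inv_inv] at this
      exact this
  · exact Camina.case_one hp hC P hPc hcard hle
end

section
/- Let G be a finite p-group such that (G, Z(G)) is a Camina pair and |Z(G)| ≥ p². Then |Aut_c(G)| ≥ |G|, where Aut_c(G) is the group of class-preserving automorphisms of G. -/
namespace CaminaAux

open Subgroup

lemma exists_equiv (p : ℕ) [Fact p.Prime] (Z : Type*) [CommGroup Z] [Finite Z]
    (h : ∀ z : Z, z ^ p = 1) :
    ∃ r : ℕ, Nonempty (Z ≃* (Fin r → Multiplicative (ZMod p))) := by
  letI : Module (ZMod p) (Additive Z) := AddCommGroup.zmodModule (n := p) (fun x => h x.toMul)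
  haveI : Module.Finite (ZMod p) (Additive Z) := Module.Finite.of_finite
  let b := (Module.finBasis (ZMod p) (Additive Z)).equivFun
  refine ⟨_, ⟨⟨⟨fun z i => Multiplicative.ofAdd (b (Additive.ofMul z) i),
    fun v => (b.symm fun i => (v i).toAdd).toMul, ?_, ?_⟩, ?_⟩⟩⟩
  · intro z
    simp
  · intro v
    simp
  · intro x y
    funext i
    simp

open scoped IsMulCommutative

variable {G : Type*} [Group G]

/-- second center -/
def Z2 (G : Type*) [Group G] : Subgroup G :=
  (center (G ⧸ center G)).comap (QuotientGroup.mk' (center G))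

lemma mem_Z2 {x : G} : x ∈ Z2 G ↔ ∀ g : G, g * x * g⁻¹ * x⁻¹ ∈ center G := by
  rw [Z2, Subgroup.mem_comap, Subgroup.mem_center_iff]
  constructor
  · intro h g
    have := h (QuotientGroup.mk' (center G) g)
    rw [← QuotientGroup.ker_mk' (center G), MonoidHom.mem_ker]
    simp only [map_mul, map_inv, this]
    group
  · intro h q
    obtain ⟨g, rfl⟩ := QuotientGroup.mk'_surjective _ q
    have := h g
    rw [← QuotientGroup.ker_mk' (center G), MonoidHom.mem_ker] at this
    simp only [map_mul, map_inv] at this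
    rwa [mul_inv_eq_one, mul_inv_eq_iff_eq_mul] at this

lemma comm_mul_right (x g h : G) (hx : x ∈ Z2 G) :
    (g * h) * x * (g * h)⁻¹ * x⁻¹ = (g * x * g⁻¹ * x⁻¹) * (h * x * h⁻¹ * x⁻¹) := by
  have hc := mem_Z2.1 hx h
  rw [mem_center_iff] at hc
  rw [hc (g * x * g⁻¹ * x⁻¹) |>.trans ?_]
  rw [← mul_assoc, ← mul_assoc, ← mul_assoc, ← hc g]
  group

lemma comm_mul_left (x y g : G) (hy : y ∈ Z2 G) :
    g * (x * y) * g⁻¹ * (x * y)⁻¹ = (g * x * g⁻¹ * x⁻¹) * (g * y * g⁻¹ * y⁻¹) := by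
  have hc := mem_Z2.1 hy g
  rw [mem_center_iff] at hc
  have := hc x⁻¹
  rw [mul_assoc (g * x * g⁻¹), this]
  group

/-- commutator map -/
def Phi1 (x : Z2 G) : G →* center G :=
  MonoidHom.mk' (fun g => ⟨g * x * g⁻¹ * (x : G)⁻¹, mem_Z2.1 x.2 g⟩)
    (fun g h => Subtype.ext (comm_mul_right _ _ _ x.2))

lemma Phi1_center (x : Z2 G) (z : G) (hz : z ∈ center G) : Phi1 x z = 1 := by
  apply Subtype.ext
  change z * x * z⁻¹ * (x : G)⁻¹ = 1
  rw [← mem_center_iff.1 hz x]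
  group

/-- commutator map on the quotient -/
def Phi (G : Type*) [Group G] : Z2 G →* ((G ⧸ center G) →* center G) :=
  MonoidHom.mk' (fun x => QuotientGroup.lift _ (Phi1 x) (Phi1_center x)) (by
    intro x y
    ext g
    exact comm_mul_left _ _ _ y.2)

lemma Phi_apply (x : Z2 G) (g : G) : (Phi G x (g : G ⧸ center G) : G) = g * x * g⁻¹ * (x : G)⁻¹ := rfl

lemma Phi_surj (hC : IsCaminaPairCenter G) (x : Z2 G) (hx : (x : G) ∉ center G) :
    Function.Surjective (Phi G x) := by
  intro z
  obtain ⟨g, hg⟩ := isConj_iff.1 (hC.2.2 x hx z z.2)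
  refine ⟨(g : G ⧸ center G), Subtype.ext ?_⟩
  rw [Phi_apply, hg, mem_center_iff.1 z.2 x]
  group

lemma exists_elt {p : ℕ} [Fact p.Prime] [Finite G] (hp : IsPGroup p G)
    (hC : IsCaminaPairCenter G) : ∃ x : Z2 G, (x : G) ∉ center G ∧ (x : G) ^ p ∈ center G := by
  have hQ : IsPGroup p (G ⧸ center G) := hp.to_quotient _
  haveI : Nontrivial (G ⧸ center G) := QuotientGroup.nontrivial_iff.2 hC.2.1
  haveI := hQ.center_nontrivial
  have hdvd : p ∣ Nat.card (center (G ⧸ center G)) := by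
    obtain ⟨n, hn, h⟩ := (hQ.to_subgroup (center (G ⧸ center G))).nontrivial_iff_card.1 inferInstance
    rw [h]; exact dvd_pow_self _ hn.ne'
  obtain ⟨⟨q, hq⟩, ho⟩ := exists_prime_orderOf_dvd_card' p hdvd
  obtain ⟨x, rfl⟩ := QuotientGroup.mk'_surjective _ q
  refine ⟨⟨x, hq⟩, ?_, ?_⟩
  · intro hx
    rw [← QuotientGroup.ker_mk' (center G), MonoidHom.mem_ker] at hx
    have : orderOf (⟨_, hq⟩ : center (G ⧸ center G)) = 1 := by
      rw [orderOf_eq_one_iff]; exact Subtype.ext hx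
    rw [this] at ho
    exact (Fact.out : p.Prime).one_lt.ne ho
  · have := pow_orderOf_eq_one (⟨_, hq⟩ : center (G ⧸ center G))
    rw [ho] at this
    have := congrArg Subtype.val this
    rw [← QuotientGroup.ker_mk' (center G), MonoidHom.mem_ker, map_pow]
    exact this

lemma exp_center {p : ℕ} [Fact p.Prime] [Finite G] (hp : IsPGroup p G)
    (hC : IsCaminaPairCenter G) (z : center G) : z ^ p = 1 := by
  obtain ⟨x, hx, hxp⟩ := exists_elt hp hC
  obtain ⟨q, rfl⟩ := Phi_surj hC x hx z
  have : Phi G (x ^ p) q = 1 := by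
    obtain ⟨g, rfl⟩ := QuotientGroup.mk_surjective q
    apply Subtype.ext
    rw [Phi_apply]
    change g * (x : G) ^ p * g⁻¹ * ((x : G) ^ p)⁻¹ = 1
    rw [mem_center_iff.1 hxp g]
    group
  rw [map_pow] at this
  exact this

/-- central automorphism -/
def cAut (f : (G ⧸ center G) →* center G) : MulAut G where
  toFun g := g * f g
  invFun g := g * (f g)⁻¹
  left_inv g := by
    have : ((g * (f g : G) : G) : G ⧸ center G) = g := by
      rw [eq_comm, QuotientGroup.eq]; simp
    simp only [this]; simp
  right_inv g := by
    have : ((g * (f g : G)⁻¹ : G) : G ⧸ center G) = g := by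
      rw [eq_comm, QuotientGroup.eq]; simp
    simp only [this]; simp
  map_mul' g h := by
    have := mem_center_iff.1 (f g).2 h
    simp only [QuotientGroup.mk_mul, map_mul, Subgroup.coe_mul]
    rw [mul_assoc g, ← mul_assoc h, this]
    group

lemma cAut_apply (f : (G ⧸ center G) →* center G) (g : G) : cAut f g = g * f g := rfl

lemma cAut_conj (hC : IsCaminaPairCenter G) (f : (G ⧸ center G) →* center G) (g : G) :
    IsConj g (cAut f g) := by
  rw [cAut_apply]
  by_cases hg : g ∈ center G
  · have : (g : G ⧸ center G) = 1 := (QuotientGroup.eq_one_iff g).2 hg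
    rw [this, map_one, Subgroup.coe_one, mul_one]
  · exact hC.2.2 g hg _ (f g).2

lemma card_ge [Finite G] (hC : IsCaminaPairCenter G) :
    Nat.card (G ⧸ Z2 G) * Nat.card ((G ⧸ center G) →* center G) ≤
      Nat.card {α : MulAut G // ∀ x : G, IsConj x (α x)} := by
  rw [← Nat.card_prod]
  let F : (G ⧸ Z2 G) × ((G ⧸ center G) →* center G) →
      {α : MulAut G // ∀ x : G, IsConj x (α x)} := fun a =>
    ⟨MulAut.conj a.1.out * cAut a.2, fun x => (cAut_conj hC a.2 x).trans
      (isConj_iff.2 ⟨a.1.out, rfl⟩)⟩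
  haveI : Finite (MulAut G) := Finite.of_injective (fun α : MulAut G => (α : G → G)) DFunLike.coe_injective
  refine Nat.card_le_card_of_injective F ?_
  rintro ⟨a, f⟩ ⟨b, h⟩ hab
  have key : ∀ x : G, a.out * (x * f x) * a.out⁻¹ = b.out * (x * h x) * b.out⁻¹ :=
    fun x => DFunLike.congr_fun (congrArg Subtype.val hab) x
  have hab' : a = b := by
    rw [← a.out_eq', ← b.out_eq']
    apply QuotientGroup.eq.2
    rw [← inv_mem_iff, mul_inv_rev, inv_inv]
    apply Subgroup.mem_comap.2
    rw [Subgroup.mem_center_iff]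
    intro q
    obtain ⟨g, rfl⟩ := QuotientGroup.mk'_surjective _ q
    have := congrArg (QuotientGroup.mk' (center G)) (key g)
    have hh : ∀ z : center G, QuotientGroup.mk' (center G) (z : G) = 1 := fun z =>
      (QuotientGroup.eq_one_iff (z : G)).2 z.2
    simp only [map_mul, map_inv, hh, mul_one] at this
    simp only [map_mul, map_inv]
    rw [mul_inv_eq_iff_eq_mul] at this
    rw [mul_assoc, this]
    group
  subst hab'
  congr 1
  ext q
  have := key q
  simpa using this

lemma card_Z2_le {p : ℕ} [Fact p.Prime] [Finite G] (hp : IsPGroup p G)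
    (hC : IsCaminaPairCenter G) (hZ : p ^ 2 ≤ Nat.card (center G)) :
    Nat.card (Z2 G) ≤ Nat.card ((G ⧸ center G) →* center G) := by
  obtain ⟨r, ⟨e⟩⟩ := exists_equiv p (center G) (exp_center hp hC)
  have hpp : p.Prime := Fact.out
  haveI : NeZero p := ⟨hpp.ne_zero⟩
  haveI : Finite (Multiplicative (ZMod p)) := inferInstanceAs (Finite (ZMod p))
  have hcard : Nat.card (center G) = p ^ r := by
    rw [Nat.card_congr e.toEquiv, Nat.card_fun]
    simp
  have hr : 2 ≤ r := by
    rw [hcard] at hZ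
    exact (Nat.pow_le_pow_iff_right hpp.one_lt).1 hZ
  haveI : Finite ((G ⧸ center G) →* Multiplicative (ZMod p)) :=
    Finite.of_injective (fun α => (α : _ → _)) DFunLike.coe_injective
  haveI : Finite ((G ⧸ center G) →* center G) :=
    Finite.of_injective (fun α => (α : _ → _)) DFunLike.coe_injective
  set D := Nat.card ((G ⧸ center G) →* Multiplicative (ZMod p)) with hD
  have hA : D ^ r ≤ Nat.card ((G ⧸ center G) →* center G) := by
    have : Nat.card (Fin r → ((G ⧸ center G) →* Multiplicative (ZMod p))) = D ^ r := by
      rw [Nat.card_fun]; simp [hD]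
    rw [← this]
    refine Nat.card_le_card_of_injective (fun f => e.symm.toMonoidHom.comp (MonoidHom.mk' (fun q i => f i q)
      (fun a b => by funext i; simp))) ?_
    intro f g hfg
    funext i
    ext q
    have h1 := DFunLike.congr_fun hfg (q : G ⧸ center G)
    have h2 := e.symm.injective h1
    exact congrFun h2 i
  have hZD : p ^ r ≤ D := by
    obtain ⟨x, hx, -⟩ := exists_elt hp hC
    have hs := Phi_surj hC x hx
    have : Nat.card (Fin r → ZMod p) = p ^ r := by rw [Nat.card_fun]; simp
    rw [← this]
    refine Nat.card_le_card_of_injective (fun v => MonoidHom.mk'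
      (fun q => Multiplicative.ofAdd (∑ i, v i * (e (Phi G x q) i).toAdd)) ?_) ?_
    · intro a b
      simp [mul_add, Finset.sum_add_distrib]
    · intro v w hvw
      funext i
      obtain ⟨q, hq⟩ := hs (e.symm (fun j => Multiplicative.ofAdd (if j = i then 1 else 0)))
      have h1 : (∑ j, v j * (e (Phi G x q) j).toAdd) = ∑ j, w j * (e (Phi G x q) j).toAdd :=
        DFunLike.congr_fun hvw q
      simpa [hq] using h1
  have hZ2 : Nat.card (Z2 G) ≤ D * p ^ r := by
    let i0 : Fin r := ⟨0, by omega⟩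
    let l : center G →* Multiplicative (ZMod p) := (Pi.evalMonoidHom _ i0).comp e.toMonoidHom
    let Ψ : Z2 G →* ((G ⧸ center G) →* Multiplicative (ZMod p)) :=
      MonoidHom.mk' (fun x => l.comp (Phi G x)) (by
        intro x y
        ext q
        simp)
    have h1 := Subgroup.card_eq_card_quotient_mul_card_subgroup Ψ.ker
    rw [h1]
    refine Nat.mul_le_mul ?_ ?_
    · exact Nat.card_le_card_of_injective _ (QuotientGroup.kerLift_injective Ψ)
    · rw [← hcard]
      refine Nat.card_le_card_of_injective (fun x => (⟨(x : Z2 G), ?_⟩ : center G)) ?_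
      · by_contra hx
        obtain ⟨q, hq⟩ := Phi_surj hC _ hx (e.symm (fun _ => Multiplicative.ofAdd 1))
        have h2 : l (Phi G x q) = 1 := DFunLike.congr_fun (MonoidHom.mem_ker.1 x.2) q
        rw [hq] at h2
        have h3 : l (e.symm (fun _ => Multiplicative.ofAdd 1)) = Multiplicative.ofAdd 1 := by
          simp [l]
        rw [h3] at h2
        have : (1 : ZMod p) = 0 := h2
        exact one_ne_zero this
      · intro x y hxy
        have h4 := congrArg (fun c : center G => (c : G)) hxy
        exact Subtype.ext (Subtype.ext h4)
  calc Nat.card (Z2 G) ≤ D * p ^ r := hZ2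
    _ ≤ D * D := Nat.mul_le_mul_left _ hZD
    _ = D ^ 2 := (sq D).symm
    _ ≤ D ^ r := Nat.pow_le_pow_right (lt_of_lt_of_le (pow_pos hpp.pos r) hZD) hr
    _ ≤ _ := hA

end CaminaAux


/-- If `(G, Z(G))` is a Camina pair for a finite `p`-group `G` with `|Z(G)| ≥ p ^ 2`,
then `|Aut_c(G)| ≥ |G|`. -/
theorem card_le_card_classPreserving {p : ℕ} [Fact p.Prime] {G : Type*} [Group G]
    [Finite G] (hp : IsPGroup p G) (hC : IsCaminaPairCenter G)
    (hZ : p ^ 2 ≤ Nat.card (Subgroup.center G)) :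
    Nat.card G ≤ Nat.card {α : MulAut G // ∀ x : G, IsConj x (α x)} := by
  rw [Subgroup.card_eq_card_quotient_mul_card_subgroup (CaminaAux.Z2 G)]
  exact (Nat.mul_le_mul_left _ (CaminaAux.card_Z2_le hp hC hZ)).trans (CaminaAux.card_ge hC)
end
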